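/- arXiv:1305.1073 — 4 statements merged into one kernel-verified Lean document; each statement's English description precedes it below -/
import Mathlib

section
/- Let r ≥ 2, let α ≥ 1 be a real number, and let G be an r-graph of order n. Then r!·e(G)/n^{r/α} ≤ λ^(α)(G) ≤ (r!·e(G))^{1−1/α}. Moreover, if G contains at least one edge, then the second inequality is strict: λ^(α)(G) < (r!·e(G))^{1−1/α}. -/
/-!
Common definitions: `r`-uniform hypergraphs on vertex set `Fin n`, the polyform,
the parameter `λ^(α)`, degrees, properties of `r`-graphs, blow-ups, extremal
numbers and chromatic numbers.
-/

open Finset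

/-- An `r`-uniform hypergraph on the vertex set `Fin n`. -/
structure HGraph (r n : ℕ) where
  edges : Finset (Finset (Fin n))
  uniform : ∀ e ∈ edges, e.card = r

namespace HGraph

/-- The polyform `P_G(x) = r! ∑_{e ∈ E(G)} ∏_{i ∈ e} x_i`. -/
noncomputable def polyform {r n : ℕ} (G : HGraph r n) (x : Fin n → ℝ) : ℝ :=
  (r.factorial : ℝ) * ∑ e ∈ G.edges, ∏ i ∈ e, x i

/-- `λ^(α)(G)`: the maximum of the polyform over the unit sphere of `ℓ^α`. -/
noncomputable def lam {r n : ℕ} (α : ℝ) (G : HGraph r n) : ℝ :=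
  sSup {y : ℝ | ∃ x : Fin n → ℝ, (∑ i, |x i| ^ α) = 1 ∧ y = G.polyform x}

/-- The degree of a vertex: the number of edges containing it. -/
def degree {r n : ℕ} (G : HGraph r n) (v : Fin n) : ℕ :=
  (G.edges.filter (fun e => v ∈ e)).card

/-- Maximum degree `Δ(G)`. -/
def maxDeg {r n : ℕ} (G : HGraph r n) : ℕ :=
  Finset.univ.sup G.degree

/-- Minimum degree `δ(G)`. -/
noncomputable def minDeg {r n : ℕ} (G : HGraph r n) : ℕ :=
  sInf (Set.range G.degree)

/-- `G` is regular if all vertices have equal degrees. -/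
def Regular {r n : ℕ} (G : HGraph r n) : Prop :=
  ∀ u v : Fin n, G.degree u = G.degree v

/-- The induced subgraph of `G` along the embedding `f`. -/
def induce {r n m : ℕ} (G : HGraph r n) (f : Fin m ↪ Fin n) : HGraph r m where
  edges := Finset.univ.filter (fun e : Finset (Fin m) => e.map f ∈ G.edges)
  uniform := by
    intro e he
    rw [Finset.mem_filter] at he
    have h2 := G.uniform _ he.2
    rwa [Finset.card_map] at h2

/-- A property of `r`-graphs: a family closed under isomorphism (relabeling). -/
def IsProperty {r : ℕ} (P : ∀ n, Set (HGraph r n)) : Prop :=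
  ∀ n : ℕ, ∀ σ : Equiv.Perm (Fin n), ∀ G ∈ P n, G.induce σ.toEmbedding ∈ P n

/-- A hereditary property: closed under taking induced subgraphs. -/
def Hereditary {r : ℕ} (P : ∀ n, Set (HGraph r n)) : Prop :=
  ∀ n m : ℕ, ∀ f : Fin m ↪ Fin n, ∀ G ∈ P n, G.induce f ∈ P m

/-- A monotone property: closed under taking subgraphs. -/
def MonotoneProp {r : ℕ} (P : ∀ n, Set (HGraph r n)) : Prop :=
  ∀ n m : ℕ, ∀ f : Fin m ↪ Fin n, ∀ G ∈ P n, ∀ H : HGraph r m,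
    (∀ e ∈ H.edges, e.map f ∈ G.edges) → H ∈ P m

/-- `B`, together with the projection `φ : V(B) → V(G)`, is (a copy of) the blow-up
`G(k 1, …, k n)` of `G`: the fiber over a vertex `i` of `G` has `k i` vertices, and the
edges of `B` are exactly the transversals of the classes corresponding to edges of `G`. -/
def IsBlowup {r n N : ℕ} (G : HGraph r n) (k : Fin n → ℕ)
    (B : HGraph r N) (φ : Fin N → Fin n) : Prop :=
  (∀ i : Fin n, (Finset.univ.filter (fun v => φ v = i)).card = k i) ∧
  ∀ s : Finset (Fin N), s ∈ B.edges ↔ (Set.InjOn φ ↑s ∧ s.image φ ∈ G.edges)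

/-- A multiplicative property: contains all blow-ups of all of its members. -/
def MultiplicativeProp {r : ℕ} (P : ∀ n, Set (HGraph r n)) : Prop :=
  ∀ n : ℕ, ∀ G ∈ P n, ∀ k : Fin n → ℕ, (∀ i, 0 < k i) →
    ∀ N : ℕ, ∀ B : HGraph r N, ∀ φ : Fin N → Fin n, IsBlowup G k B φ → B ∈ P N

/-- The extremal number `ex(P, n)`: the maximum number of edges of a member of `P`
of order `n`. -/
noncomputable def exP {r : ℕ} (P : ∀ n, Set (HGraph r n)) (n : ℕ) : ℕ :=
  sSup {m : ℕ | ∃ G ∈ P n, G.edges.card = m}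

/-- `λ^(α)(P, n)`: the maximum of `λ^(α)(G)` over members `G` of `P` of order `n`. -/
noncomputable def lamP {r : ℕ} (α : ℝ) (P : ∀ n, Set (HGraph r n)) (n : ℕ) : ℝ :=
  sSup {y : ℝ | ∃ G ∈ P n, y = lam α G}

/-- The chromatic number: the least `k` such that the vertices can be `k`-colored
with no monochromatic edge (i.e. partitioned into `k` edgeless sets). -/
noncomputable def chrom {r n : ℕ} (G : HGraph r n) : ℕ :=
  sInf {k : ℕ | ∃ c : Fin n → Fin k, ∀ e ∈ G.edges, ¬ ∀ u ∈ e, ∀ w ∈ e, c u = c w}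

/-- The weak chromatic number: the least `k` such that the vertices can be `k`-colored
with every edge getting `r` distinct colors (every class meets every edge in ≤ 1 vertex). -/
noncomputable def wchrom {r n : ℕ} (G : HGraph r n) : ℕ :=
  sInf {k : ℕ | ∃ c : Fin n → Fin k, ∀ e ∈ G.edges, Set.InjOn c ↑e}

/-- `Mon(H)`: the (monotone, hereditary) property of all `r`-graphs containing no
subgraph isomorphic to `H`. -/
def MonP {r h : ℕ} (H : HGraph r h) : ∀ n, Set (HGraph r n) :=
  fun n => {G | ¬ ∃ f : Fin h ↪ Fin n, ∀ e ∈ H.edges, e.map f ∈ G.edges}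

end HGraph

open HGraph

/-- The polyform at a nonnegative vector together with a pure power is part of the multinomial
expansion of the `r`-th power of the sum. -/
theorem HGraph.polyform_add_pow_le {r n : ℕ} (hr : 2 ≤ r) (G : HGraph r n) {a : Fin n → ℝ}
    (ha : ∀ i, 0 ≤ a i) (i₀ : Fin n) : G.polyform a + a i₀ ^ r ≤ (∑ i, a i) ^ r := by
  classical
  rw [Finset.sum_pow_eq_sum_piAntidiag]
  let χ : Finset (Fin n) → Fin n → ℕ := fun e i => if i ∈ e then 1 else 0
  have hχ : Function.Injective χ := fun e f h => by
    ext i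
    have := congrFun h i
    by_cases h1 : i ∈ e <;> by_cases h2 : i ∈ f <;> simp_all [χ]
  have hsum : ∀ e ∈ G.edges, ∑ i, χ e i = r := fun e he => by
    simp [χ, G.uniform e he]
  have hnot : Pi.single i₀ r ∉ G.edges.image χ := fun h => by
    obtain ⟨e, -, he⟩ := Finset.mem_image.1 h
    have h2 := congrFun he i₀
    have h3 : χ e i₀ ≤ 1 := by
      simp only [χ]
      split_ifs <;> simp
    simp at h2
    omega
  have hsub : insert (Pi.single i₀ r) (G.edges.image χ) ⊆ Finset.piAntidiag univ r := by
    intro k hk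
    rw [Finset.mem_piAntidiag]
    refine ⟨?_, by simp⟩
    rcases Finset.mem_insert.1 hk with rfl | hk
    · simp
    · obtain ⟨e, he, rfl⟩ := Finset.mem_image.1 hk
      exact hsum e he
  refine le_trans ?_ (Finset.sum_le_sum_of_subset_of_nonneg hsub fun k _ _ =>
    mul_nonneg (Nat.cast_nonneg _) (Finset.prod_nonneg fun i _ => pow_nonneg (ha i) _))
  rw [Finset.sum_insert hnot, Finset.sum_image hχ.injOn, add_comm]
  refine add_le_add ?_ (le_of_eq ?_)
  · have hprod : ∏ i, a i ^ (Pi.single i₀ r : Fin n → ℕ) i = a i₀ ^ r := by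
      rw [Finset.prod_eq_single i₀]
      · simp
      · intro b _ hb
        simp [Pi.single_eq_of_ne hb]
      · simp
    rw [hprod]
    exact le_mul_of_one_le_left (pow_nonneg (ha _) _)
      (by exact_mod_cast Nat.multinomial_pos _ _)
  · rw [polyform, Finset.mul_sum]
    refine Finset.sum_congr rfl fun e he => ?_
    have hm : Nat.multinomial univ (χ e) = r.factorial := by
      have h1 : ∏ i, (χ e i).factorial = 1 := Finset.prod_eq_one fun i _ => by
        simp only [χ]
        split_ifs <;> simp
      have := Nat.multinomial_spec univ (χ e)
      rwa [h1, one_mul, hsum e he] at this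
    rw [hm]
    congr 1
    simp [χ, pow_ite, Finset.prod_ite_mem]

/-- Convexity of `t ↦ t ^ α` bounds the polyform at `x` by the one at `|x| ^ α`. -/
theorem HGraph.polyform_le_rpow {r n : ℕ} {α : ℝ} (hα : 1 ≤ α) (G : HGraph r n)
    (x : Fin n → ℝ) :
    G.polyform x ≤ ((r.factorial : ℝ) * G.edges.card) ^ (1 - 1 / α) *
      G.polyform (fun i => |x i| ^ α) ^ (1 / α) := by
  have h0 : 0 < α := by linarith
  have hr : (0 : ℝ) < r.factorial := by exact_mod_cast r.factorial_pos
  have hP : 0 ≤ G.polyform (fun i => |x i| ^ α) :=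
    mul_nonneg hr.le (Finset.sum_nonneg fun e _ => Finset.prod_nonneg fun i _ => by positivity)
  have hm : (0 : ℝ) ≤ (r.factorial : ℝ) * G.edges.card := by positivity
  have hS : 0 ≤ ∑ e ∈ G.edges, |∏ i ∈ e, x i| := Finset.sum_nonneg fun e _ => abs_nonneg _
  have key : ((r.factorial : ℝ) * ∑ e ∈ G.edges, |∏ i ∈ e, x i|) ^ α ≤
      ((r.factorial : ℝ) * G.edges.card) ^ (α - 1) * G.polyform (fun i => |x i| ^ α) := by
    have h := Real.rpow_sum_le_const_mul_sum_rpow G.edges (fun e => ∏ i ∈ e, x i) hα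
    rw [Real.mul_rpow hr.le hS, Real.mul_rpow hr.le (Nat.cast_nonneg _), polyform]
    have e1 : (r.factorial : ℝ) ^ α = (r.factorial : ℝ) ^ (α - 1) * r.factorial := by
      rw [← Real.rpow_add_one hr.ne']
      simp
    have e2 : ∀ e : Finset (Fin n), ∏ i ∈ e, |x i| ^ α = |∏ i ∈ e, x i| ^ α := fun e => by
      rw [Finset.abs_prod, Real.finsetProd_rpow _ _ fun i _ => abs_nonneg _]
    simp only [e2]
    calc _ ≤ (r.factorial : ℝ) ^ α * _ := mul_le_mul_of_nonneg_left h (by positivity)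
      _ = _ := by rw [e1]; ring
  calc G.polyform x ≤ (r.factorial : ℝ) * ∑ e ∈ G.edges, |∏ i ∈ e, x i| :=
        mul_le_mul_of_nonneg_left (Finset.sum_le_sum fun e _ => le_abs_self _) hr.le
    _ = (((r.factorial : ℝ) * ∑ e ∈ G.edges, |∏ i ∈ e, x i|) ^ α) ^ (1 / α) := by
        rw [← Real.rpow_mul (by positivity), mul_one_div_cancel h0.ne', Real.rpow_one]
    _ ≤ (((r.factorial : ℝ) * G.edges.card) ^ (α - 1) *
        G.polyform (fun i => |x i| ^ α)) ^ (1 / α) :=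
        Real.rpow_le_rpow (by positivity) key (by positivity)
    _ = _ := by
        rw [Real.mul_rpow (by positivity) hP, ← Real.rpow_mul hm]
        congr 2
        field_simp

/-- A bound for the polyform on the unit sphere of `ℓ^α`, uniform in the vector. -/
theorem HGraph.polyform_le_of_sum_eq_one {r n : ℕ} (hr : 2 ≤ r) {α : ℝ} (hα : 1 ≤ α)
    (G : HGraph r n) {x : Fin n → ℝ} (hx : ∑ i, |x i| ^ α = 1) :
    G.polyform x ≤ ((r.factorial : ℝ) * G.edges.card) ^ (1 - 1 / α) *
      (1 - ((n : ℝ)⁻¹) ^ r) ^ (1 / α) := by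
  have hn : 0 < n := by
    rcases Nat.eq_zero_or_pos n with rfl | h
    · simp at hx
    · exact h
  have hn' : (n : ℝ) ≠ 0 := by exact_mod_cast hn.ne'
  have : Nonempty (Fin n) := ⟨⟨0, hn⟩⟩
  obtain ⟨i₀, -, hi⟩ : ∃ i ∈ (univ : Finset (Fin n)), (n : ℝ)⁻¹ ≤ |x i| ^ α := by
    refine Finset.exists_le_of_sum_le univ_nonempty ?_
    simp [hx, hn']
  have h := G.polyform_add_pow_le hr (a := fun i => |x i| ^ α) (fun i => by positivity) i₀
  rw [hx, one_pow] at h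
  have h2 : ((n : ℝ)⁻¹) ^ r ≤ (|x i₀| ^ α) ^ r := pow_le_pow_left₀ (by positivity) hi r
  refine (G.polyform_le_rpow hα x).trans (mul_le_mul_of_nonneg_left ?_ (by positivity))
  refine Real.rpow_le_rpow (mul_nonneg (by positivity) (Finset.sum_nonneg fun e _ =>
    Finset.prod_nonneg fun i _ => by positivity)) ?_ (by positivity)
  linarith

/-- Proposition 1: for `α ≥ 1` and an `r`-graph `G` of order `n`,
`r!·e(G)/n^{r/α} ≤ λ^(α)(G) ≤ (r!·e(G))^{1−1/α}`, with strict second inequality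
whenever `G` has at least one edge. -/
theorem stmt0 {r n : ℕ} (hr : 2 ≤ r) (α : ℝ) (hα : 1 ≤ α) (G : HGraph r n) :
    (r.factorial : ℝ) * G.edges.card / (n : ℝ) ^ ((r : ℝ) / α) ≤ lam α G ∧
    lam α G ≤ ((r.factorial : ℝ) * G.edges.card) ^ (1 - 1 / α) ∧
    (G.edges.Nonempty → lam α G < ((r.factorial : ℝ) * G.edges.card) ^ (1 - 1 / α)) := by
  classical
  set m : ℝ := (r.factorial : ℝ) * G.edges.card with hm
  have hm0 : 0 ≤ m := by positivity
  have hα0 : 0 < α := by linarith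
  have hc0 : 0 ≤ 1 - ((n : ℝ)⁻¹) ^ r :=
    sub_nonneg.2 (pow_le_one₀ (by positivity) (Nat.cast_inv_le_one n))
  have hc1 : (1 - ((n : ℝ)⁻¹) ^ r) ^ (1 / α) ≤ 1 :=
    Real.rpow_le_one hc0 (sub_le_self _ (by positivity)) (by positivity)
  have hub : ∀ y ∈ {y : ℝ | ∃ x : Fin n → ℝ, (∑ i, |x i| ^ α) = 1 ∧ y = G.polyform x},
      y ≤ m ^ (1 - 1 / α) * (1 - ((n : ℝ)⁻¹) ^ r) ^ (1 / α) := by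
    rintro y ⟨x, hx, rfl⟩
    exact G.polyform_le_of_sum_eq_one hr hα hx
  have hlam : lam α G ≤ m ^ (1 - 1 / α) * (1 - ((n : ℝ)⁻¹) ^ r) ^ (1 / α) :=
    Real.sSup_le hub (by positivity)
  refine ⟨?_, hlam.trans (mul_le_of_le_one_right (by positivity) hc1), fun hne => ?_⟩
  · rcases Nat.eq_zero_or_pos n with rfl | hn
    · have hE : G.edges = ∅ := Finset.eq_empty_of_forall_notMem fun e he => by
        have h1 := G.uniform e he
        have h2 := Finset.card_le_univ e
        simp at h2
        simp [h2] at h1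
        omega
      simp [hm, hE, lam]
    · have hn' : (0 : ℝ) < n := by exact_mod_cast hn
      refine le_csSup ⟨_, hub⟩ ⟨fun _ => (n : ℝ) ^ (-(1 / α)), ?_, ?_⟩
      · have : |(n : ℝ) ^ (-(1 / α))| ^ α = (n : ℝ)⁻¹ := by
          rw [abs_of_nonneg (by positivity), ← Real.rpow_mul hn'.le, neg_mul,
            one_div_mul_cancel hα0.ne', Real.rpow_neg_one]
        rw [Finset.sum_congr rfl fun i _ => this]
        simp [hn'.ne']
      · have : ∀ e ∈ G.edges, ∏ _i ∈ e, (n : ℝ) ^ (-(1 / α)) = ((n : ℝ) ^ ((r : ℝ) / α))⁻¹ := by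
          intro e he
          rw [Finset.prod_const, G.uniform e he, ← Real.rpow_natCast, ← Real.rpow_mul hn'.le,
            ← Real.rpow_neg hn'.le]
          congr 1
          ring
        rw [polyform, Finset.sum_congr rfl this, Finset.sum_const, nsmul_eq_mul, hm]
        ring
  · have hmpos : 0 < m := mul_pos (by exact_mod_cast r.factorial_pos)
      (by exact_mod_cast hne.card_pos)
    have hn : 0 < n := by
      obtain ⟨e, he⟩ := hne
      have h1 := G.uniform e he
      have h2 := Finset.card_le_univ e
      rw [Fintype.card_fin] at h2
      omega
    refine hlam.trans_lt (mul_lt_of_lt_one_right (by positivity) ?_)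
    exact Real.rpow_lt_one hc0 (sub_lt_self _ (by positivity)) (by positivity)
end

section
/- Let r ≥ 2 and let G be an r-graph. Then the function α ↦ λ^(α)(G) is nondecreasing and continuous on [1,∞), and lim_{α→∞} λ^(α)(G) = r!·e(G). -/
/-!
Common definitions: `r`-uniform hypergraphs on vertex set `Fin n`, the polyform,
the parameter `λ^(α)`, degrees, properties of `r`-graphs, blow-ups, extremal
numbers and chromatic numbers.
-/

open Finset

open HGraph

namespace HGraph

variable {r n : ℕ}

theorem abs_le_one_of_sum_rpow_eq_one {α : ℝ} (hα : 1 ≤ α) {x : Fin n → ℝ}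
    (hx : ∑ i, |x i| ^ α = 1) (i : Fin n) : |x i| ≤ 1 := by
  have h : |x i| ^ α ≤ 1 := hx ▸ Finset.single_le_sum (f := fun i => |x i| ^ α)
    (fun j _ => Real.rpow_nonneg (abs_nonneg _) _) (Finset.mem_univ i)
  by_contra! h1
  exact absurd h (not_le.mpr (Real.one_lt_rpow h1 (by linarith)))

theorem prod_abs_le_one {α : ℝ} (hα : 1 ≤ α) {x : Fin n → ℝ}
    (hx : ∑ i, |x i| ^ α = 1) (e : Finset (Fin n)) : ∏ i ∈ e, |x i| ≤ 1 :=
  Finset.prod_le_one (fun _ _ => abs_nonneg _)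
    (fun i _ => abs_le_one_of_sum_rpow_eq_one hα hx i)

theorem polyform_le_polyform_abs (G : HGraph r n) (x : Fin n → ℝ) :
    G.polyform x ≤ G.polyform fun i => |x i| := by
  unfold polyform
  refine mul_le_mul_of_nonneg_left (Finset.sum_le_sum fun e _ => ?_) (by positivity)
  rw [← Finset.abs_prod]
  exact le_abs_self _

theorem polyform_le (G : HGraph r n) {α : ℝ} (hα : 1 ≤ α) {x : Fin n → ℝ}
    (hx : ∑ i, |x i| ^ α = 1) : G.polyform x ≤ (r.factorial : ℝ) * G.edges.card := by
  refine (G.polyform_le_polyform_abs x).trans ?_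
  unfold polyform
  gcongr
  simpa using Finset.sum_le_card_nsmul G.edges _ 1 fun e _ => prod_abs_le_one hα hx e

theorem lam_le (G : HGraph r n) {α : ℝ} (hα : 1 ≤ α) :
    lam α G ≤ (r.factorial : ℝ) * G.edges.card := by
  refine Real.sSup_le ?_ (by positivity)
  rintro _ ⟨x, hx, rfl⟩
  exact G.polyform_le hα hx

theorem polyform_le_lam (G : HGraph r n) {α : ℝ} (hα : 1 ≤ α) {x : Fin n → ℝ}
    (hx : ∑ i, |x i| ^ α = 1) : G.polyform x ≤ lam α G := by
  refine le_csSup ⟨(r.factorial : ℝ) * G.edges.card, ?_⟩ ⟨x, hx, rfl⟩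
  rintro _ ⟨x, hx, rfl⟩
  exact G.polyform_le hα hx

theorem lam_nonneg (G : HGraph r n) {α : ℝ} (hα : 1 ≤ α) : 0 ≤ lam α G := by
  by_cases h : ∃ x : Fin n → ℝ, ∑ i, |x i| ^ α = 1
  · obtain ⟨x, hx⟩ := h
    refine le_trans ?_ (G.polyform_le_lam hα (x := fun i => |x i|) (by simpa using hx))
    unfold polyform
    positivity
  · have : {y : ℝ | ∃ x : Fin n → ℝ, (∑ i, |x i| ^ α) = 1 ∧ y = G.polyform x} = ∅ := by
      ext y
      simp only [Set.mem_ofPred_eq, Set.mem_empty_iff_false, iff_false]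
      rintro ⟨x, hx, -⟩
      exact h ⟨x, hx⟩
    rw [lam, this, Real.sSup_empty]

/-- Coordinatewise powers carry the `ℓ^α` unit sphere to the `ℓ^β` unit sphere. -/
theorem sum_abs_rpow_rpow {α β : ℝ} (hβ : 1 ≤ β) (x : Fin n → ℝ) :
    ∑ i, |(|x i| ^ (α / β))| ^ β = ∑ i, |x i| ^ α := by
  refine Finset.sum_congr rfl fun i _ => ?_
  rw [abs_of_nonneg (by positivity), ← Real.rpow_mul (abs_nonneg _),
    div_mul_cancel₀ _ (by positivity)]

theorem lam_mono (G : HGraph r n) {α β : ℝ} (hα : 1 ≤ α) (hαβ : α ≤ β) :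
    lam α G ≤ lam β G := by
  have hβ := hα.trans hαβ
  refine Real.sSup_le ?_ (G.lam_nonneg hβ)
  rintro _ ⟨x, hx, rfl⟩
  refine (G.polyform_le_polyform_abs x).trans (le_trans ?_
    (G.polyform_le_lam hβ ((sum_abs_rpow_rpow hβ x).trans hx)))
  unfold polyform
  gcongr with e he i hi
  exact Real.self_le_rpow_of_le_one (abs_nonneg _) (abs_le_one_of_sum_rpow_eq_one hα hx i)
    ((div_le_one (by linarith)).mpr hαβ)

theorem sub_le_rpow {p t : ℝ} (hp : 0 ≤ p) (ht : 1 ≤ t) : p - (t - 1) ≤ p ^ t := by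
  have h := one_add_mul_self_le_rpow_one_add (s := p - 1) (by linarith) ht
  rw [add_sub_cancel] at h
  nlinarith [mul_nonneg hp (sub_nonneg.mpr ht)]

theorem lam_sub_le (G : HGraph r n) {α β : ℝ} (hα : 1 ≤ α) (hαβ : α ≤ β) :
    lam β G ≤ lam α G + (r.factorial : ℝ) * G.edges.card * (β - α) := by
  have hβ := hα.trans hαβ
  have hd : 0 ≤ β - α := sub_nonneg.mpr hαβ
  refine Real.sSup_le ?_ (add_nonneg (G.lam_nonneg hα) (by positivity))
  rintro _ ⟨x, hx, rfl⟩
  refine (G.polyform_le_polyform_abs x).trans (le_trans ?_ (add_le_add_left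
    (G.polyform_le_lam hα ((sum_abs_rpow_rpow hα x).trans hx)) _))
  unfold polyform
  rw [mul_assoc, ← mul_add]
  gcongr
  rw [← nsmul_eq_mul, ← Finset.sum_const, ← Finset.sum_add_distrib]
  refine Finset.sum_le_sum fun e _ => ?_
  rw [Real.finsetProd_rpow _ _ fun i _ => abs_nonneg _]
  have ht : 1 ≤ β / α := (one_le_div (by linarith)).mpr hαβ
  have h := sub_le_rpow (Finset.prod_nonneg fun i (_ : i ∈ e) => abs_nonneg (x i)) ht
  have h2 : β / α - 1 ≤ β - α := by
    rw [div_sub_one (by positivity)]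
    exact div_le_self hd hα
  linarith

theorem lipschitzOnWith_lam (G : HGraph r n) :
    LipschitzOnWith (r.factorial * G.edges.card) (fun α : ℝ => lam α G) (Set.Ici 1) := by
  refine LipschitzOnWith.of_le_add_mul _ fun α hα β hβ => ?_
  rw [Set.mem_Ici] at hα hβ
  push_cast
  rcases le_total α β with h | h
  · exact (G.lam_mono hα h).trans (le_add_of_nonneg_right (by positivity))
  · rw [Real.dist_eq, abs_of_nonneg (sub_nonneg.mpr h)]
    exact G.lam_sub_le hβ h

theorem le_lam (G : HGraph r n) (hn : n ≠ 0) {α : ℝ} (hα : 1 ≤ α) :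
    (r.factorial : ℝ) * (G.edges.card * ((n : ℝ) ^ (-α⁻¹)) ^ r) ≤ lam α G := by
  have h0 : (n : ℝ) ≠ 0 := Nat.cast_ne_zero.mpr hn
  have hx : ∑ _i : Fin n, |(n : ℝ) ^ (-α⁻¹)| ^ α = 1 := by
    rw [abs_of_nonneg (by positivity), ← Real.rpow_mul (by positivity), neg_mul,
      inv_mul_cancel₀ (by positivity), Real.rpow_neg_one]
    simp [h0]
  refine le_of_eq_of_le ?_ (G.polyform_le_lam hα hx)
  unfold polyform
  rw [← nsmul_eq_mul (G.edges.card), ← Finset.sum_const]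
  congr 1
  refine Finset.sum_congr rfl fun e he => ?_
  rw [Finset.prod_const, G.uniform e he]

theorem tendsto_lam (G : HGraph r n) (hr : r ≠ 0) :
    Filter.Tendsto (fun α : ℝ => lam α G) Filter.atTop
      (nhds ((r.factorial : ℝ) * G.edges.card)) := by
  have hle := (Filter.eventually_ge_atTop (1 : ℝ)).mono fun α hα => G.lam_le hα
  rcases eq_or_ne n 0 with rfl | hn
  · have he : G.edges = ∅ := Finset.eq_empty_of_forall_notMem fun e he =>
      hr (by rw [← G.uniform e he, Finset.eq_empty_of_isEmpty e, Finset.card_empty])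
    refine tendsto_of_tendsto_of_tendsto_of_le_of_le' tendsto_const_nhds tendsto_const_nhds
      ?_ hle
    filter_upwards [Filter.eventually_ge_atTop 1] with α hα
    simpa [he] using G.lam_nonneg hα
  · refine tendsto_of_tendsto_of_tendsto_of_le_of_le' ?_ tendsto_const_nhds
      ((Filter.eventually_ge_atTop 1).mono fun α hα => G.le_lam hn hα) hle
    have h1 : Filter.Tendsto (fun α : ℝ => (n : ℝ) ^ (-α⁻¹)) Filter.atTop (nhds 1) := by
      simpa using (tendsto_const_nhds (x := (n : ℝ))).rpow
        tendsto_inv_atTop_zero.neg (Or.inl (Nat.cast_ne_zero.mpr hn))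
    simpa using ((h1.pow r).const_mul (G.edges.card : ℝ)).const_mul (r.factorial : ℝ)

end HGraph

/-- Proposition 2: for an `r`-graph `G`, the function
`α ↦ λ^(α)(G)` is nondecreasing and continuous on `[1, ∞)`, and
`λ^(α)(G) → r!·e(G)` as `α → ∞`. -/
theorem stmt1 {r n : ℕ} (hr : 2 ≤ r) (G : HGraph r n) :
    MonotoneOn (fun α : ℝ => lam α G) (Set.Ici 1) ∧
    ContinuousOn (fun α : ℝ => lam α G) (Set.Ici 1) ∧
    Filter.Tendsto (fun α : ℝ => lam α G) Filter.atTop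
      (nhds ((r.factorial : ℝ) * G.edges.card)) := by
  exact ⟨fun α hα β _ h => G.lam_mono hα h, G.lipschitzOnWith_lam.continuousOn,
    G.tendsto_lam (by omega)⟩
end

section
/- Let r ≥ 2, let α ≥ 1 be a real number, let k ≥ 1 be an integer, and let G_1 and G_2 be r-graphs on the same vertex set whose edge sets differ in at most k edges (the symmetric difference of E(G_1) and E(G_2) has at most k elements). Then |λ^(α)(G_1) − λ^(α)(G_2)| ≤ (r!·k)^{1−1/α}. -/
/-!
Common definitions: `r`-uniform hypergraphs on vertex set `Fin n`, the polyform,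
the parameter `λ^(α)`, degrees, properties of `r`-graphs, blow-ups, extremal
numbers and chromatic numbers.
-/

open Finset

open HGraph

/-- The squarefree part of the multinomial expansion of `(∑ i, y i) ^ r` is at most the
whole expansion. -/
theorem factorial_mul_sum_prod_le_sum_pow {ι : Type*} [Fintype ι] [DecidableEq ι] {r : ℕ}
    (D : Finset (Finset ι)) (hD : ∀ e ∈ D, e.card = r) (y : ι → ℝ) (hy : ∀ i, 0 ≤ y i) :
    (r.factorial : ℝ) * ∑ e ∈ D, ∏ i ∈ e, y i ≤ (∑ i, y i) ^ r := by
  let φ : Finset ι → ι → ℕ := fun e i => if i ∈ e then 1 else 0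
  have hφ : Function.Injective φ := by
    intro a b hab
    ext i
    have := congrFun hab i
    by_cases ha : i ∈ a <;> by_cases hb : i ∈ b <;> simp_all [φ]
  have hsub : D.image φ ⊆ piAntidiag univ r := by
    intro f hf
    obtain ⟨e, he, rfl⟩ := mem_image.1 hf
    simp [mem_piAntidiag, φ, hD e he]
  rw [sum_pow_eq_sum_piAntidiag]
  refine le_trans (le_of_eq ?_) (sum_le_sum_of_subset_of_nonneg hsub fun f _ _ =>
    mul_nonneg (Nat.cast_nonneg _) (prod_nonneg fun i _ => pow_nonneg (hy i) _))
  rw [sum_image hφ.injOn, mul_sum]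
  refine sum_congr rfl fun e he => ?_
  have hmul : Nat.multinomial univ (φ e) = r.factorial := by
    have hfac : ∏ i, (φ e i).factorial = 1 :=
      prod_eq_one fun i _ => by by_cases hi : i ∈ e <;> simp [φ, hi]
    have hsum : ∑ i, φ e i = r := by simp [φ, hD e he]
    have := Nat.multinomial_spec univ (φ e)
    rwa [hfac, hsum, one_mul] at this
  have hprod : ∏ i, y i ^ φ e i = ∏ i ∈ e, y i := by
    simp [φ, pow_ite, prod_ite_mem]
  rw [hmul, hprod]

/-- A polyform with at most `k` edges is at most `(r! k) ^ (1 - 1 / α)` on the unit sphere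
of `ℓ^α`. -/
theorem factorial_mul_sum_prod_abs_le {ι : Type*} [Fintype ι] [DecidableEq ι] {r k : ℕ}
    {α : ℝ} (hα : 1 ≤ α) (D : Finset (Finset ι)) (hD : ∀ e ∈ D, e.card = r)
    (hk : D.card ≤ k) (x : ι → ℝ) (hx : ∑ i, |x i| ^ α = 1) :
    (r.factorial : ℝ) * ∑ e ∈ D, ∏ i ∈ e, |x i| ≤ ((r.factorial : ℝ) * k) ^ (1 - 1 / α) := by
  have hα0 : 0 < α := by linarith
  have hp : ∀ e : Finset ι, 0 ≤ ∏ i ∈ e, |x i| := fun e => prod_nonneg fun i _ => abs_nonneg _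
  set S := ∑ e ∈ D, ∏ i ∈ e, |x i| with hS
  have hS0 : 0 ≤ S := sum_nonneg fun e _ => hp e
  have hr0 : (0 : ℝ) < r.factorial := by positivity
  have hholder : S ^ α ≤ (D.card : ℝ) ^ (α - 1) * ∑ e ∈ D, (∏ i ∈ e, |x i|) ^ α :=
    Real.rpow_sum_le_const_mul_sum_rpow_of_nonneg D hα fun e _ => hp e
  have hpow : (r.factorial : ℝ) * ∑ e ∈ D, (∏ i ∈ e, |x i|) ^ α ≤ 1 := by
    have h := factorial_mul_sum_prod_le_sum_pow D hD (fun i => |x i| ^ α)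
      fun i => Real.rpow_nonneg (abs_nonneg _) _
    rw [hx, one_pow] at h
    refine le_trans (le_of_eq ?_) h
    congr 1
    exact sum_congr rfl fun e _ =>
      (Real.finsetProd_rpow e (fun i => |x i|) (fun i _ => abs_nonneg _) α).symm
  have hmain : ((r.factorial : ℝ) * S) ^ α ≤ ((r.factorial : ℝ) * k) ^ (α - 1) := by
    calc ((r.factorial : ℝ) * S) ^ α
        = (r.factorial : ℝ) ^ (α - 1) * r.factorial * S ^ α := by
          rw [Real.mul_rpow hr0.le hS0, Real.rpow_sub_one hr0.ne', div_mul_cancel₀ _ hr0.ne']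
      _ ≤ (r.factorial : ℝ) ^ (α - 1) * r.factorial *
            ((D.card : ℝ) ^ (α - 1) * ∑ e ∈ D, (∏ i ∈ e, |x i|) ^ α) := by gcongr
      _ = (r.factorial : ℝ) ^ (α - 1) * (D.card : ℝ) ^ (α - 1) *
            (r.factorial * ∑ e ∈ D, (∏ i ∈ e, |x i|) ^ α) := by ring
      _ ≤ (r.factorial : ℝ) ^ (α - 1) * (D.card : ℝ) ^ (α - 1) * 1 := by gcongr
      _ ≤ (r.factorial : ℝ) ^ (α - 1) * (k : ℝ) ^ (α - 1) := by
          rw [mul_one]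
          gcongr
      _ = ((r.factorial : ℝ) * k) ^ (α - 1) := (Real.mul_rpow hr0.le k.cast_nonneg).symm
  have hexp : 1 - 1 / α = (α - 1) * α⁻¹ := by field_simp
  rw [hexp, Real.rpow_mul (by positivity)]
  exact (Real.le_rpow_inv_iff_of_pos (by positivity) (by positivity) hα0).2 hmain

/-- The polyforms of two hypergraphs differ by at most the sum over the edges in which
they differ. -/
theorem HGraph.polyform_sub_le {r n : ℕ} (G₁ G₂ : HGraph r n) (x : Fin n → ℝ) :
    G₁.polyform x - G₂.polyform x ≤
      (r.factorial : ℝ) * ∑ e ∈ symmDiff G₁.edges G₂.edges, ∏ i ∈ e, |x i| := by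
  rw [polyform, polyform, ← mul_sub]
  refine mul_le_mul_of_nonneg_left ?_ (Nat.cast_nonneg _)
  have hdisj : Disjoint (G₁.edges \ G₂.edges) (G₂.edges \ G₁.edges) := disjoint_sdiff_sdiff
  rw [← sum_sdiff_sub_sum_sdiff, symmDiff_def, sup_eq_union, sum_union hdisj, sub_eq_add_neg,
    ← sum_neg_distrib]
  refine add_le_add (sum_le_sum fun e _ => ?_) (sum_le_sum fun e _ => ?_)
  · exact (le_abs_self _).trans_eq (abs_prod _ _)
  · exact (neg_le_abs _).trans_eq (abs_prod _ _)

theorem HGraph.uniform_of_mem_symmDiff {r n : ℕ} (G₁ G₂ : HGraph r n) :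
    ∀ e ∈ symmDiff G₁.edges G₂.edges, e.card = r := by
  intro e he
  rcases mem_symmDiff.1 he with h | h
  · exact G₁.uniform e h.1
  · exact G₂.uniform e h.1

theorem HGraph.bddAbove_polyform {r n : ℕ} {α : ℝ} (hα : 1 ≤ α) (G : HGraph r n) :
    BddAbove {y : ℝ | ∃ x : Fin n → ℝ, (∑ i, |x i| ^ α) = 1 ∧ y = G.polyform x} := by
  refine ⟨((r.factorial : ℝ) * G.edges.card) ^ (1 - 1 / α), ?_⟩
  rintro _ ⟨x, hx, rfl⟩
  refine le_trans ?_ (factorial_mul_sum_prod_abs_le hα G.edges G.uniform le_rfl x hx)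
  refine mul_le_mul_of_nonneg_left (sum_le_sum fun e _ => ?_) (Nat.cast_nonneg _)
  exact (le_abs_self _).trans_eq (abs_prod _ _)

theorem HGraph.lam_sub_le_s7 {r n k : ℕ} {α : ℝ} (hα : 1 ≤ α) (G₁ G₂ : HGraph r n)
    (hdiff : (symmDiff G₁.edges G₂.edges).card ≤ k) :
    lam α G₁ - lam α G₂ ≤ ((r.factorial : ℝ) * k) ^ (1 - 1 / α) := by
  by_cases hne : ∃ x : Fin n → ℝ, ∑ i, |x i| ^ α = 1
  · rw [sub_le_iff_le_add]
    obtain ⟨x₀, hx₀⟩ := hne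
    refine csSup_le ⟨_, x₀, hx₀, rfl⟩ ?_
    rintro _ ⟨x, hx, rfl⟩
    have h₁ := G₁.polyform_sub_le G₂ x
    have h₂ := factorial_mul_sum_prod_abs_le hα _ (G₁.uniform_of_mem_symmDiff G₂) hdiff x hx
    have h₃ : G₂.polyform x ≤ lam α G₂ := le_csSup (G₂.bddAbove_polyform hα) ⟨x, hx, rfl⟩
    linarith
  · have hzero : ∀ G : HGraph r n, lam α G = 0 := by
      intro G
      have hempty : {y : ℝ | ∃ x : Fin n → ℝ, (∑ i, |x i| ^ α) = 1 ∧ y = G.polyform x} = ∅ :=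
        Set.eq_empty_of_forall_notMem fun y ⟨x, hx, _⟩ => hne ⟨x, hx⟩
      rw [lam, hempty, Real.sSup_empty]
    rw [hzero, hzero, sub_zero]
    positivity

/-- Proposition 10: if the `r`-graphs `G₁`, `G₂` on the same vertex
set differ in at most `k ≥ 1` edges, then
`|λ^(α)(G₁) − λ^(α)(G₂)| ≤ (r!·k)^{1−1/α}`. -/
theorem stmt7 {r n : ℕ} (hr : 2 ≤ r) (α : ℝ) (hα : 1 ≤ α) (k : ℕ) (hk : 1 ≤ k)
    (G₁ G₂ : HGraph r n) (hdiff : (symmDiff G₁.edges G₂.edges).card ≤ k) :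
    |lam α G₁ - lam α G₂| ≤ ((r.factorial : ℝ) * k) ^ (1 - 1 / α) := by
  refine abs_sub_le_iff.2 ⟨lam_sub_le_s7 hα G₁ G₂ hdiff, lam_sub_le_s7 hα G₂ G₁ ?_⟩
  rwa [symmDiff_comm]
end

section
/- Let r ≥ 2, let 1 < α ≤ r, and let G be an r-graph of order n ≥ 2 with minimum degree δ and λ = λ^(α)(G). Let x = (x_1,…,x_n) be a nonnegative vector with x_1^α + ⋯ + x_n^α = 1 and λ = P_G(x), and set x = min{x_1,…,x_n}. Then ((λ·n^{r/α−1}/(r−1)!)^α − δ^α)·x^{α(r−1)} ≤ C(n−1,r−1)·δ^{α−1}·((1−x^α)^{r−1}/(n−1)^{r−1} − x^{α(r−1)}). -/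
/-!
Common definitions: `r`-uniform hypergraphs on vertex set `Fin n`, the polyform,
the parameter `λ^(α)`, degrees, properties of `r`-graphs, blow-ups, extremal
numbers and chromatic numbers.
-/

open Finset

open HGraph

theorem pow_mul_add_le_add_pow {a d : ℝ} (ha : 0 ≤ a) (had : 0 ≤ a + d) (k : ℕ) :
    a ^ k * (a + (k + 1) * d) ≤ (a + d) ^ (k + 1) := by
  induction k with
  | zero => simp
  | succ k ih =>
    have h1 := mul_le_mul_of_nonneg_right ih had
    have h2 : 0 ≤ a ^ k * ((k + 1) * d ^ 2) := by positivity
    rw [pow_succ (a + d) (k + 1)]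
    push_cast
    refine le_trans ?_ h1
    rw [pow_succ]
    linarith [h2]

/-- Maclaurin's inequality between an elementary symmetric sum and the arithmetic mean. -/
theorem sum_powersetCard_prod_le {ι : Type*} [DecidableEq ι] (s : Finset ι) (y : ι → ℝ)
    (hy : ∀ i, 0 ≤ y i) (k : ℕ) :
    ∑ t ∈ s.powersetCard k, ∏ i ∈ t, y i ≤
      (s.card.choose k : ℝ) * ((∑ i ∈ s, y i) / s.card) ^ k := by
  induction s using Finset.induction_on generalizing k with
  | empty =>
    cases k with
    | zero => simp
    | succ k => simp [powersetCard_eq_empty.2 (by simp : (∅ : Finset ι).card < k + 1)]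
  | insert a s ha ih =>
    cases k with
    | zero => simp
    | succ k =>
      rw [powersetCard_succ_insert ha, sum_union, sum_image, sum_insert ha, card_insert_of_notMem ha]
      · have h1 := ih (k + 1)
        have h2 := mul_le_mul_of_nonneg_left (ih k) (hy a)
        have h3 : ∑ t ∈ s.powersetCard k, ∏ i ∈ insert a t, y i =
            y a * ∑ t ∈ s.powersetCard k, ∏ i ∈ t, y i := by
          rw [mul_sum]
          refine sum_congr rfl fun t ht => prod_insert fun hat => ha ?_
          exact (mem_powersetCard.1 ht).1 hat
        rw [h3]
        have hsum : 0 ≤ ∑ i ∈ s, y i := sum_nonneg fun i _ => hy i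
        set m := s.card with hm
        set A := (∑ i ∈ s, y i) / (m : ℝ) with hA
        have hA0 : 0 ≤ A := by positivity
        have hmA : (m : ℝ) * A = ∑ i ∈ s, y i := by
          rcases Nat.eq_zero_or_pos m with h0 | h0
          · have : s = ∅ := by rw [← card_eq_zero, ← hm, h0]
            simp [this, h0]
          · rw [hA]; field_simp
        have hm1 : (0 : ℝ) < m + 1 := by positivity
        have hB : (y a + ∑ i ∈ s, y i) / ((m + 1 : ℕ) : ℝ) = A + (y a - A) / (m + 1) := by
          rw [← hmA]; push_cast; field_simp; ring
        have hB0 : 0 ≤ A + (y a - A) / (m + 1) := by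
          rw [← hB]; have := hy a; positivity
        have hb := pow_mul_add_le_add_pow hA0 hB0 k
        rw [hB]
        have hc1 : ((m : ℝ) + 1) * (m.choose k) = ((m + 1).choose (k + 1)) * ((k : ℝ) + 1) := by
          exact_mod_cast Nat.add_one_mul_choose_eq m k
        have hc2 : (((m + 1).choose (k + 1) : ℕ) : ℝ) = m.choose k + m.choose (k + 1) := by
          exact_mod_cast Nat.choose_succ_succ m k
        refine le_trans ?_ (mul_le_mul_of_nonneg_left hb (Nat.cast_nonneg _))
        refine le_trans (add_le_add h1 h2) (le_of_eq ?_)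
        have hc3 : ((m + 1).choose (k + 1) : ℝ) * ((k + 1) * ((y a - A) / (m + 1))) =
            m.choose k * (y a - A) := by
          rw [← mul_assoc, ← hc1]; field_simp
        have : ((m + 1).choose (k + 1) : ℝ) * (A ^ k * (A + (k + 1) * ((y a - A) / (m + 1)))) =
            A ^ k * (((m + 1).choose (k + 1) : ℝ) * A + m.choose k * (y a - A)) := by
          rw [← hc3]; ring
        rw [this, hc2]
        ring
      · intro t ht u hu htu
        have hat : a ∉ t := fun h => ha ((mem_powersetCard.1 ht).1 h)
        have hau : a ∉ u := fun h => ha ((mem_powersetCard.1 hu).1 h)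
        rw [← erase_insert hat, ← erase_insert hau]
        exact congrArg (fun v => v.erase a) htu
      · rw [disjoint_left]
        intro t ht ht'
        obtain ⟨u, -, rfl⟩ := mem_image.1 ht'
        exact ha ((mem_powersetCard.1 ht).1 (mem_insert_self a u))

namespace HGraph

variable {r n : ℕ} (G : HGraph r n)

theorem polyform_nonneg {x : Fin n → ℝ} (hx : ∀ i, 0 ≤ x i) : 0 ≤ G.polyform x :=
  by
  unfold polyform
  exact mul_nonneg (Nat.cast_nonneg _) (sum_nonneg fun _ _ => prod_nonneg fun i _ => hx i)

theorem polyform_smul (c : ℝ) (x : Fin n → ℝ) :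
    G.polyform (fun i => c * x i) = c ^ r * G.polyform x := by
  unfold polyform
  rw [mul_left_comm]
  congr 1
  rw [mul_sum]
  refine sum_congr rfl fun e he => ?_
  rw [prod_mul_distrib, prod_const, G.uniform e he]

theorem bddAbove_polyform_sphere {α : ℝ} (hα : 0 < α) :
    BddAbove {y : ℝ | ∃ x : Fin n → ℝ, (∑ i, |x i| ^ α) = 1 ∧ y = G.polyform x} := by
  refine ⟨r.factorial * G.edges.card, ?_⟩
  rintro y ⟨x, hx, rfl⟩
  have hle : ∀ i, |x i| ≤ 1 := by
    intro i
    have h : |x i| ^ α ≤ 1 := by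
      rw [← hx]
      exact single_le_sum (f := fun i => |x i| ^ α)
        (fun j _ => Real.rpow_nonneg (abs_nonneg _) _) (mem_univ i)
    by_contra! h1
    exact (Real.one_lt_rpow h1 hα).not_ge h
  unfold polyform
  gcongr
  refine (sum_le_card_nsmul _ _ 1 fun e _ => ?_).trans (by simp)
  refine (le_abs_self _).trans ?_
  rw [abs_prod]
  exact prod_le_one (fun i _ => abs_nonneg _) fun i _ => hle i

theorem polyform_le_lam_mul_rpow {α : ℝ} (hα : 0 < α) {y : Fin n → ℝ} (hy : ∀ i, 0 ≤ y i)
    (hpos : 0 < ∑ i, y i ^ α) :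
    G.polyform y ≤ lam α G * (∑ i, y i ^ α) ^ ((r : ℝ) / α) := by
  set S := ∑ i, y i ^ α with hS
  have hc : 0 < S ^ (1 / α) := Real.rpow_pos_of_pos hpos _
  have hcα : (S ^ (1 / α)) ^ α = S := by
    rw [← Real.rpow_mul hpos.le, one_div_mul_cancel hα.ne', Real.rpow_one]
  have hcr : (S ^ (1 / α)) ^ r = S ^ ((r : ℝ) / α) := by
    rw [← Real.rpow_natCast, ← Real.rpow_mul hpos.le]
    congr 1
    ring
  have h : G.polyform (fun i => (S ^ (1 / α))⁻¹ * y i) ≤ lam α G := by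
    refine le_csSup (G.bddAbove_polyform_sphere hα) ⟨_, ?_, rfl⟩
    have : ∀ i, |(S ^ (1 / α))⁻¹ * y i| ^ α = S⁻¹ * y i ^ α := by
      intro i
      rw [abs_of_nonneg (mul_nonneg (inv_nonneg.2 hc.le) (hy i)),
        Real.mul_rpow (inv_nonneg.2 hc.le) (hy i), Real.inv_rpow hc.le, hcα]
    simp_rw [this]
    rw [← mul_sum, ← hS, inv_mul_cancel₀ hpos.ne']
  rw [polyform_smul, inv_pow, hcr, inv_mul_le_iff₀ (Real.rpow_pos_of_pos hpos _)] at h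
  linarith

/-- The sum over the edges through `v` of the products of the other coordinates. -/
noncomputable def linkSum (x : Fin n → ℝ) (v : Fin n) : ℝ :=
  ∑ e ∈ G.edges with v ∈ e, ∏ i ∈ e.erase v, x i

theorem polyform_update (x : Fin n → ℝ) (v : Fin n) (t : ℝ) :
    G.polyform (Function.update x v t) =
      r.factorial * (∑ e ∈ G.edges with v ∉ e, ∏ i ∈ e, x i) +
        r.factorial * G.linkSum x v * t := by
  unfold polyform linkSum
  rw [← sum_filter_add_sum_filter_not G.edges (fun e => v ∈ e), mul_add, add_comm, mul_assoc]
  congr 2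
  · refine sum_congr rfl fun e he => prod_congr rfl fun i hi => ?_
    rw [Function.update_of_ne]
    rintro rfl
    exact (mem_filter.1 he).2 hi
  · rw [sum_mul]
    refine sum_congr rfl fun e he => ?_
    rw [← prod_erase_mul e _ (mem_filter.1 he).2, Function.update_self]
    congr 1
    refine prod_congr rfl fun i hi => ?_
    rw [Function.update_of_ne (ne_of_mem_erase hi)]

/-- The eigenequation at a positive coordinate of a maximizer. -/
theorem lam_mul_rpow_eq {α : ℝ} (hr : 1 ≤ r) (hα : 1 < α) {x : Fin n → ℝ}
    (hx0 : ∀ i, 0 ≤ x i) (hxs : ∑ i, x i ^ α = 1) (hmax : lam α G = G.polyform x)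
    {v : Fin n} (hv : 0 < x v) :
    lam α G * x v ^ (α - 1) = (r - 1).factorial * G.linkSum x v := by
  have hα0 : 0 < α := by linarith
  set a := r.factorial * (∑ e ∈ G.edges with v ∉ e, ∏ i ∈ e, x i) with ha
  set b := r.factorial * G.linkSum x v with hb
  set c := ∑ i ∈ univ.erase v, x i ^ α with hc
  have hc0 : 0 ≤ c := sum_nonneg fun i _ => Real.rpow_nonneg (hx0 i) _
  have hcv : c + x v ^ α = 1 := by
    rw [← hxs, hc, sum_erase_add _ _ (mem_univ v)]
  set h : ℝ → ℝ := fun t => lam α G * (c + t ^ α) ^ ((r : ℝ) / α) - (a + b * t) with hh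
  have hmin : IsLocalMin h (x v) := by
    have hx : h (x v) = 0 := by
      have := G.polyform_update x v (x v)
      rw [Function.update_eq_self] at this
      simp only [hh]
      rw [hcv, Real.one_rpow, hmax, this]
      ring
    filter_upwards [lt_mem_nhds hv] with t ht
    rw [hx]
    have hsum : ∑ i, Function.update x v t i ^ α = c + t ^ α := by
      rw [← sum_erase_add _ _ (mem_univ v), Function.update_self, hc]
      congr 1
      refine sum_congr rfl fun i hi => ?_
      rw [Function.update_of_ne (ne_of_mem_erase hi)]
    have htα := Real.rpow_pos_of_pos ht α
    have := G.polyform_le_lam_mul_rpow hα0 (y := Function.update x v t) (fun i => by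
      rcases eq_or_ne i v with rfl | hi
      · rw [Function.update_self]; exact ht.le
      · rw [Function.update_of_ne hi]; exact hx0 i) (by rw [hsum]; linarith)
    rw [hsum, polyform_update] at this
    simp only [hh]
    linarith
  have hderiv : HasDerivAt h
      (lam α G * (α * x v ^ (α - 1) * ((r : ℝ) / α) * (c + x v ^ α) ^ ((r : ℝ) / α - 1)) - b)
      (x v) := by
    have h1 : HasDerivAt (fun t : ℝ => c + t ^ α) (α * x v ^ (α - 1)) (x v) :=
      (Real.hasDerivAt_rpow_const (Or.inl hv.ne')).const_add c
    have h2 := (h1.rpow_const (p := (r : ℝ) / α) (Or.inl (by rw [hcv]; norm_num))).const_mul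
      (lam α G)
    have h3 : HasDerivAt (fun t : ℝ => a + b * t) b (x v) := by
      simpa using ((hasDerivAt_id (x v)).const_mul b).const_add a
    exact h2.sub h3
  have h0 := hmin.hasDerivAt_eq_zero hderiv
  rw [hcv, Real.one_rpow, mul_one] at h0
  have hr0 : (0 : ℝ) < r := by exact_mod_cast hr
  have hfac : (r.factorial : ℝ) = r * (r - 1).factorial := by
    exact_mod_cast (Nat.mul_factorial_pred (by omega)).symm
  have h4 : α * x v ^ (α - 1) * ((r : ℝ) / α) = r * x v ^ (α - 1) := by
    field_simp
  rw [h4, hb, hfac] at h0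
  apply mul_left_cancel₀ hr0.ne'
  linarith

/-- Hölder's inequality for `linkSum`. -/
theorem linkSum_rpow_le {α : ℝ} (hα : 1 ≤ α) {x : Fin n → ℝ} (hx0 : ∀ i, 0 ≤ x i)
    (v : Fin n) :
    G.linkSum x v ^ α ≤ (G.degree v : ℝ) ^ (α - 1) * G.linkSum (fun i => x i ^ α) v := by
  unfold linkSum degree
  refine (Real.rpow_sum_le_const_mul_sum_rpow_of_nonneg _ hα
    fun e _ => prod_nonneg fun i _ => hx0 i).trans_eq ?_
  congr 1
  exact sum_congr rfl fun e _ => (Real.finsetProd_rpow _ _ (fun i _ => hx0 i) α).symm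

theorem linkSum_add_le {y : Fin n → ℝ} {m : ℝ} (hm : 0 ≤ m) (hy : ∀ i, m ≤ y i) (v : Fin n) :
    G.linkSum y v + (((n - 1).choose (r - 1) : ℝ) - G.degree v) * m ^ (r - 1) ≤
      ∑ t ∈ (univ.erase v).powersetCard (r - 1), ∏ i ∈ t, y i := by
  set L := (G.edges.filter (fun e => v ∈ e)).image (fun e => e.erase v) with hL
  have hinj : Set.InjOn (fun e : Finset (Fin n) => e.erase v)
      (G.edges.filter (fun e => v ∈ e)) := by
    intro e he f hf hef
    rw [← insert_erase (mem_filter.1 he).2, ← insert_erase (mem_filter.1 hf).2]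
    exact congrArg (insert v) hef
  have hsub : L ⊆ (univ.erase v).powersetCard (r - 1) := by
    intro t ht
    obtain ⟨e, he, rfl⟩ := mem_image.1 ht
    obtain ⟨he, hve⟩ := mem_filter.1 he
    rw [mem_powersetCard, card_erase_of_mem hve, G.uniform e he]
    exact ⟨erase_subset_erase v (subset_univ e), rfl⟩
  have hcard : L.card = G.degree v := card_image_of_injOn hinj
  have hsum : G.linkSum y v = ∑ t ∈ L, ∏ i ∈ t, y i := by
    rw [hL, sum_image hinj]; rfl
  have hcard' : ((((univ.erase v).powersetCard (r - 1)) \ L).card : ℝ) =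
      ((n - 1).choose (r - 1) : ℝ) - G.degree v := by
    rw [cast_card_sdiff hsub, hcard, card_powersetCard, card_erase_of_mem (mem_univ v), card_univ,
      Fintype.card_fin]
  rw [← sum_sdiff hsub, hsum, add_comm, ← hcard', ← nsmul_eq_mul]
  gcongr
  refine card_nsmul_le_sum _ _ _ fun t ht => ?_
  rw [← (mem_powersetCard.1 (mem_sdiff.1 ht).1).2, ← prod_const]
  exact prod_le_prod (fun _ _ => hm) fun i _ => hy i

end HGraph

/-- Lemma 1: let `1 < α ≤ r`, let `G` be an `r`-graph of order
`n ≥ 2` with minimum degree `δ` and `λ = λ^(α)(G)`, and let `x` be a nonnegative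
vector on the `ℓ^α` unit sphere with `λ = P_G(x)`. Then, with `xm = min_i x_i`,
`((λ·n^{r/α−1}/(r−1)!)^α − δ^α)·xm^{α(r−1)}
  ≤ C(n−1, r−1)·δ^{α−1}·((1−xm^α)^{r−1}/(n−1)^{r−1} − xm^{α(r−1)})`. -/
theorem stmt8 {r n : ℕ} (hr : 2 ≤ r) (hn : 2 ≤ n) (α : ℝ) (hα1 : 1 < α)
    (hαr : α ≤ r) (G : HGraph r n) (x : Fin n → ℝ) (hx0 : ∀ i, 0 ≤ x i)
    (hxs : ∑ i, x i ^ α = 1) (hmax : lam α G = G.polyform x) :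
    ((lam α G * (n : ℝ) ^ ((r : ℝ) / α - 1) / (((r - 1).factorial : ℝ))) ^ α
        - (minDeg G : ℝ) ^ α) * (sInf (Set.range x)) ^ (α * ((r : ℝ) - 1)) ≤
      ((n - 1).choose (r - 1) : ℝ) * (minDeg G : ℝ) ^ (α - 1) *
        ((1 - (sInf (Set.range x)) ^ α) ^ (r - 1) / ((n : ℝ) - 1) ^ (r - 1)
          - (sInf (Set.range x)) ^ (α * ((r : ℝ) - 1))) := by
  have hn0 : (0 : ℝ) < n := by positivity
  have hn1 : (0 : ℝ) < (n : ℝ) - 1 := by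
    have : (2 : ℝ) ≤ n := by exact_mod_cast hn
    linarith
  have hr1 : (((r - 1 : ℕ) : ℝ)) = (r : ℝ) - 1 := by
    rw [Nat.cast_sub (by omega), Nat.cast_one]
  have hr2 : (2 : ℝ) ≤ r := by exact_mod_cast hr
  have hα0 : 0 < α := by linarith
  have : Nonempty (Fin n) := ⟨⟨0, by omega⟩⟩
  set m := sInf (Set.range x) with hm
  have hmx : ∀ i, m ≤ x i := fun i => csInf_le (Set.finite_range x).bddBelow ⟨i, rfl⟩
  have hm0 : 0 ≤ m := le_csInf (Set.range_nonempty x) (by rintro _ ⟨i, rfl⟩; exact hx0 i)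
  have hpow : m ^ (α * ((r : ℝ) - 1)) = (m ^ α) ^ (r - 1) := by
    rw [Real.rpow_mul hm0, ← hr1, Real.rpow_natCast]
  obtain ⟨v, hv⟩ : ∃ v, G.degree v = minDeg G := Nat.sInf_mem (Set.range_nonempty G.degree)
  rcases hm0.eq_or_lt with h0 | hmpos
  · rw [← h0, Real.zero_rpow (by nlinarith : α * ((r : ℝ) - 1) ≠ 0), Real.zero_rpow hα0.ne']
    rw [mul_zero, sub_zero, sub_zero]
    positivity
  have hlam : 0 ≤ lam α G := hmax ▸ G.polyform_nonneg hx0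
  have hmα : 0 < m ^ α := Real.rpow_pos_of_pos hmpos α
  have hyle : ∀ i, m ^ α ≤ x i ^ α := fun i => Real.rpow_le_rpow hm0 (hmx i) hα0.le
  have hnm : n * m ^ α ≤ 1 := by
    rw [← hxs]
    simpa using card_nsmul_le_sum univ (fun i => x i ^ α) (m ^ α) fun i _ => hyle i
  set F : ℝ := ((r - 1).factorial : ℝ) with hF
  have hF0 : 0 < F := by rw [hF]; positivity
  have hbase : (lam α G * (n : ℝ) ^ ((r : ℝ) / α - 1) / F) ^ α * (m ^ α) ^ (r - 1) ≤
      (lam α G * m ^ (α - 1) / F) ^ α := by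
    have h1 : (m ^ α) ^ (r - 1) = (m ^ ((r : ℝ) - 1)) ^ α := by
      rw [← hpow, mul_comm, Real.rpow_mul hm0]
    rw [h1, ← Real.mul_rpow (by positivity) (by positivity)]
    refine Real.rpow_le_rpow (by positivity) ?_ hα0.le
    have h2 : (n : ℝ) ^ ((r : ℝ) / α - 1) * m ^ ((r : ℝ) - 1) ≤ m ^ (α - 1) := by
      have h3 : m ^ ((r : ℝ) - 1) = (m ^ α) ^ ((r : ℝ) / α - 1) * m ^ (α - 1) := by
        rw [← Real.rpow_mul hm0, ← Real.rpow_add hmpos]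
        congr 1
        field_simp
        ring
      rw [h3, ← mul_assoc, ← Real.mul_rpow hn0.le hmα.le]
      refine mul_le_of_le_one_left (by positivity) ?_
      refine Real.rpow_le_one (by positivity) hnm ?_
      rw [sub_nonneg, le_div_iff₀ hα0]
      linarith
    calc lam α G * (n : ℝ) ^ ((r : ℝ) / α - 1) / F * m ^ ((r : ℝ) - 1)
        = lam α G * ((n : ℝ) ^ ((r : ℝ) / α - 1) * m ^ ((r : ℝ) - 1)) / F := by ring
      _ ≤ lam α G * m ^ (α - 1) / F := by gcongr
  have heigen : lam α G * m ^ (α - 1) / F ≤ G.linkSum x v := by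
    rw [div_le_iff₀ hF0, mul_comm (G.linkSum x v),
      ← G.lam_mul_rpow_eq (by omega) hα1 hx0 hxs hmax (hmpos.trans_le (hmx v))]
    exact mul_le_mul_of_nonneg_left
      (Real.rpow_le_rpow hm0 (hmx v) (by linarith)) hlam
  have hpm : (lam α G * m ^ (α - 1) / F) ^ α ≤
      (minDeg G : ℝ) ^ (α - 1) * G.linkSum (fun i => x i ^ α) v := by
    rw [← hv]
    exact (Real.rpow_le_rpow (by positivity) heigen hα0.le).trans
      (G.linkSum_rpow_le hα1.le hx0 v)
  have hlink := G.linkSum_add_le hmα.le hyle v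
  have hmac : ∑ t ∈ (univ.erase v).powersetCard (r - 1), ∏ i ∈ t, x i ^ α ≤
      ((n - 1).choose (r - 1) : ℝ) * ((1 - m ^ α) ^ (r - 1) / ((n : ℝ) - 1) ^ (r - 1)) := by
    refine (sum_powersetCard_prod_le _ _ (fun i => Real.rpow_nonneg (hx0 i) α) _).trans ?_
    have hsum : ∑ i ∈ univ.erase v, x i ^ α = 1 - x v ^ α := by
      rw [← hxs, ← sum_erase_add _ _ (mem_univ v)]
      ring
    have hsum0 : 0 ≤ 1 - x v ^ α := by
      rw [← hsum]
      exact sum_nonneg fun i _ => Real.rpow_nonneg (hx0 i) α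
    rw [hsum, card_erase_of_mem (mem_univ v), card_univ, Fintype.card_fin,
      Nat.cast_sub (by omega : 1 ≤ n), Nat.cast_one, ← div_pow]
    gcongr
    exact hmx v
  have hδ : (minDeg G : ℝ) ^ α = (minDeg G : ℝ) ^ (α - 1) * minDeg G := by
    rw [← Real.rpow_add_one' (Nat.cast_nonneg _) (by linarith), sub_add_cancel]
  rw [hv] at hlink
  have hfin := mul_le_mul_of_nonneg_left (hlink.trans hmac)
    (Real.rpow_nonneg (Nat.cast_nonneg (minDeg G)) (α - 1))
  rw [hpow, hδ]
  linarith [hbase.trans hpm]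
end
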